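/- (Proposition 3(a), efficiency of competitive equilibria.) Assume the δ-hypothesis. Then for every competitive equilibrium (with bids (αᵇ,αᵖ) and prices (πᵇ,(π_sᵖ)_{s∈S})), its production schedule (qᵇ, qᵖ, (r_s)_{s∈S}), which satisfies r_1 = 0, is an optimal solution of SYSTEM. -/

import Mathlib

open Matrix Finset

noncomputable section

/-- Clamp `x` to the interval `[a,b]`: `[x]_a^b = min (max x a) b`. -/
def clamp (x a b : ℝ) : ℝ := min (max x a) b

/-- Data of the power network and market: oriented incidence matrix `C`,
positive line susceptances `Bd`, line limits `f`, positive capacity bounds,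
cost functions `cb`, `cp` on `(0,∞)` with derivatives `cb'`, `cp'` (strictly
increasing continuous bijections from `(0,∞)` onto `ℝ`, with inverses
`cbInv`, `cpInv`), and market constants `γb`, `γp`. -/
structure MarketNet (N L : ℕ) where
  C : Matrix (Fin N) (Fin L) ℝ
  Bd : Fin L → ℝ
  f : Fin L → ℝ
  qlb : Fin N → ℝ
  qub : Fin N → ℝ
  plb : Fin N → ℝ
  pub : Fin N → ℝ
  cb : Fin N → ℝ → ℝ
  cp : Fin N → ℝ → ℝ
  cb' : Fin N → ℝ → ℝ
  cp' : Fin N → ℝ → ℝ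
  cbInv : Fin N → ℝ → ℝ
  cpInv : Fin N → ℝ → ℝ
  γb : Fin N → ℝ
  γp : Fin N → ℝ

namespace MarketNet

variable {N L : ℕ} (P : MarketNet N L)

/-- The weighted Laplacian `Lap = C·B·Cᵀ`. -/
def Lap : Matrix (Fin N) (Fin N) ℝ := P.C * Matrix.diagonal P.Bd * P.Cᵀ

/-- The shift-factor matrix `H = B·Cᵀ·(Lap + (1/N)·𝟙𝟙ᵀ)⁻¹`. -/
def H : Matrix (Fin L) (Fin N) ℝ :=
  Matrix.diagonal P.Bd * P.Cᵀ *
    (P.Lap + (N : ℝ)⁻¹ • Matrix.of (fun _ _ : Fin N => (1 : ℝ)))⁻¹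

/-- Standing assumptions on the network and market data. -/
def Sane : Prop :=
  1 ≤ N ∧
  (∀ l, 0 < P.Bd l) ∧
  (∀ x : Fin N → ℝ, P.Cᵀ.mulVec x = 0 → ∃ c : ℝ, x = fun _ => c) ∧
  (∀ n, 0 < P.qlb n) ∧ (∀ n, P.qlb n ≤ P.qub n) ∧
  (∀ n, 0 < P.plb n) ∧ (∀ n, P.plb n ≤ P.pub n) ∧
  (∀ n, ∀ x ∈ Set.Ioi (0 : ℝ), HasDerivAt (P.cb n) (P.cb' n x) x) ∧
  (∀ n, ∀ x ∈ Set.Ioi (0 : ℝ), HasDerivAt (P.cp n) (P.cp' n x) x) ∧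
  (∀ n, StrictConvexOn ℝ (Set.Ioi 0) (P.cb n)) ∧
  (∀ n, StrictConvexOn ℝ (Set.Ioi 0) (P.cp n)) ∧
  (∀ n, StrictMonoOn (P.cb' n) (Set.Ioi 0)) ∧
  (∀ n, StrictMonoOn (P.cp' n) (Set.Ioi 0)) ∧
  (∀ n, ContinuousOn (P.cb' n) (Set.Ioi 0)) ∧
  (∀ n, ContinuousOn (P.cp' n) (Set.Ioi 0)) ∧
  (∀ n y, P.cbInv n y ∈ Set.Ioi (0 : ℝ) ∧ P.cb' n (P.cbInv n y) = y) ∧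
  (∀ n y, P.cpInv n y ∈ Set.Ioi (0 : ℝ) ∧ P.cp' n (P.cpInv n y) = y) ∧
  (∀ n, ∀ x ∈ Set.Ioi (0 : ℝ), P.cbInv n (P.cb' n x) = x) ∧
  (∀ n, ∀ x ∈ Set.Ioi (0 : ℝ), P.cpInv n (P.cp' n x) = x) ∧
  (∀ n, 0 < P.γb n) ∧ (∀ n, 0 < P.γp n)

/-- Nodal injections `qᵇ + qᵖ + r − d`. -/
def inj (_P : MarketNet N L) (qb qp r d : Fin N → ℝ) : Fin N → ℝ :=
  fun n => qb n + qp n + r n - d n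

/-- The feasible set `Ω(d)`. -/
def Omega (d qb qp r : Fin N → ℝ) : Prop :=
  (∀ n, P.qlb n ≤ qb n ∧ qb n ≤ P.qub n) ∧
  (∀ n, P.plb n ≤ qp n + r n ∧ qp n + r n ≤ P.pub n) ∧
  (∑ n, (qb n + qp n + r n - d n) = 0) ∧
  (∀ l, -P.f l ≤ P.H.mulVec (P.inj qb qp r d) l ∧
        P.H.mulVec (P.inj qb qp r d) l ≤ P.f l)

/-- Nodal prices `π(λ,μ̲,μ̄) = λ·𝟙 + Hᵀ(μ̲ − μ̄)`. -/
def price (lam : ℝ) (μl μu : Fin L → ℝ) (n : Fin N) : ℝ :=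
  lam + P.Hᵀ.mulVec (μl - μu) n

variable {S : Type} [Fintype S]

/-- The SYSTEM objective. -/
def sysCost (p : S → ℝ) (qb qp : Fin N → ℝ) (r : S → Fin N → ℝ) : ℝ :=
  ∑ s, p s * ∑ n, (P.cb n (qb n) + P.cp n (qp n + r s n))

/-- Feasibility for SYSTEM. -/
def SysFeas (s1 : S) (d : S → Fin N → ℝ)
    (qb qp : Fin N → ℝ) (r : S → Fin N → ℝ) : Prop :=
  (∀ s, P.Omega (d s) qb qp (r s)) ∧ r s1 = 0

/-- Optimality for SYSTEM. -/
def SysOpt (s1 : S) (p : S → ℝ) (d : S → Fin N → ℝ)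
    (qb qp : Fin N → ℝ) (r : S → Fin N → ℝ) : Prop :=
  P.SysFeas s1 d qb qp r ∧
  ∀ qb' qp' r', P.SysFeas s1 d qb' qp' r' →
    P.sysCost p qb qp r ≤ P.sysCost p qb' qp' r'

/-- The KKT system of SYSTEM at a feasible point. -/
def SystemKKT (K : ℕ) (p : S → ℝ) (d : S → Fin N → ℝ)
    (qb qp : Fin N → ℝ) (r : S → Fin N → ℝ)
    (ξl ξu : Fin N → ℝ) (νl νu : S → Fin N → ℝ)
    (μl μu : S → Fin L → ℝ) (lam : S → ℝ) : Prop :=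
  (∀ n, 0 ≤ ξl n) ∧ (∀ n, 0 ≤ ξu n) ∧
  (∀ s n, 0 ≤ νl s n) ∧ (∀ s n, 0 ≤ νu s n) ∧
  (∀ s l, 0 ≤ μl s l) ∧ (∀ s l, 0 ≤ μu s l) ∧
  (∀ n, (K : ℝ) * P.cb' n (qb n) + ξu n - ξl n
      = ∑ s, p s * P.price (lam s) (μl s) (μu s) n) ∧
  (∑ n, (ξl n * (P.qlb n - qb n) + ξu n * (qb n - P.qub n)) = 0) ∧
  (∀ s n, P.cp' n (qp n + r s n) + νu s n - νl s n
      = P.price (lam s) (μl s) (μu s) n) ∧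
  (∀ s, ∑ n, (νl s n * (P.plb n - (qp n + r s n))
            + νu s n * ((qp n + r s n) - P.pub n)) = 0) ∧
  (∀ s, ∑ l, (μl s l * (-P.f l - P.H.mulVec (P.inj qb qp (r s) (d s)) l)
            + μu s l * (P.H.mulVec (P.inj qb qp (r s) (d s)) l - P.f l)) = 0)

/-- The δ-hypothesis: there are an optimal solution of SYSTEM and multipliers
satisfying the KKT system of SYSTEM at it such that
`δ_n = ∑_s p_s (π_n(λ_s,μ̲_s,μ̄_s) − π_n(λ₁,μ̲₁,μ̄₁))` for every `n`. -/
def DeltaHyp (s1 : S) (K : ℕ) (p : S → ℝ) (d : S → Fin N → ℝ)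
    (δ : Fin N → ℝ) : Prop :=
  ∃ (qb qp : Fin N → ℝ) (r : S → Fin N → ℝ)
    (ξl ξu : Fin N → ℝ) (νl νu : S → Fin N → ℝ)
    (μl μu : S → Fin L → ℝ) (lam : S → ℝ),
    P.SysOpt s1 p d qb qp r ∧
    P.SystemKKT K p d qb qp r ξl ξu νl νu μl μu lam ∧
    ∀ n, δ n = ∑ s, p s * (P.price (lam s) (μl s) (μu s) n
                         - P.price (lam s1) (μl s1) (μu s1) n)

/-- The dispatch supply function `sₙᵇ(π) = ((cₙᵇ)′)⁻¹(π)/γₙᵇ`. -/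
def sb (n : Fin N) (π : ℝ) : ℝ := P.cbInv n π / P.γb n

/-- The regulation supply function `sₙᵖ(π) = ((cₙᵖ)′)⁻¹(π)/γₙᵖ`. -/
def sp (n : Fin N) (π : ℝ) : ℝ := P.cpInv n π / P.γp n

/-- The dispatch bid cost `ĉₙᵇ(q) = ∫_{q̲ₙᵇ}^q (cₙᵇ)′((γₙᵇ/αₙᵇ)w) dw`. -/
def cbHat (αb : Fin N → ℝ) (n : Fin N) (q : ℝ) : ℝ :=
  ∫ w in (P.qlb n)..q, P.cb' n ((P.γb n / αb n) * w)

/-- The regulation bid cost `ĉₙᵖ(q) = ∫_{q̲ₙᵖ}^q (cₙᵖ)′((γₙᵖ/αₙᵖ)w) dw`. -/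
def cpHat (αp : Fin N → ℝ) (n : Fin N) (q : ℝ) : ℝ :=
  ∫ w in (P.plb n)..q, P.cp' n ((P.γp n / αp n) * w)

/-- The `ÊD` objective `∑_n (K ĉₙᵇ(qₙᵇ) + K ĉₙᵖ(qₙᵖ) − δ_n qₙᵇ)`. -/
def edHatCost (K : ℕ) (δ : Fin N → ℝ) (αb αp qb qp : Fin N → ℝ) : ℝ :=
  ∑ n, ((K : ℝ) * P.cbHat αb n (qb n) + (K : ℝ) * P.cpHat αp n (qp n)
        - δ n * qb n)

/-- Optimality for `ÊD(d₁)`. -/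
def EDHatOpt (K : ℕ) (δ : Fin N → ℝ) (αb αp : Fin N → ℝ)
    (d1 qb qp : Fin N → ℝ) : Prop :=
  P.Omega d1 qb qp 0 ∧
  ∀ qb' qp', P.Omega d1 qb' qp' 0 →
    P.edHatCost K δ αb αp qb qp ≤ P.edHatCost K δ αb αp qb' qp'

/-- The `F̂R` objective `∑_n ĉₙᵖ(qₙᵖ + r_{s,n})`. -/
def frHatCost (αp qp r : Fin N → ℝ) : ℝ := ∑ n, P.cpHat αp n (qp n + r n)

/-- Optimality for `F̂R(qᵇ,qᵖ,d_s)`. -/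
def FRHatOpt (αp : Fin N → ℝ) (ds qb qp r : Fin N → ℝ) : Prop :=
  P.Omega ds qb qp r ∧
  ∀ r', P.Omega ds qb qp r' → P.frHatCost αp qp r ≤ P.frHatCost αp qp r'

/-- The KKT system of `ÊD(d₁)`: the single-scenario analogue of SYSTEM's with
marginal costs `(cₙᵇ)′((γₙᵇ/αₙᵇ)·)`, `(cₙᵖ)′((γₙᵖ/αₙᵖ)·)` and the extra term
`−δ_n` in the `qᵇ`-stationarity condition. -/
def EDHatKKT (K : ℕ) (δ : Fin N → ℝ) (αb αp : Fin N → ℝ) (d1 qb qp : Fin N → ℝ)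
    (ξl ξu νl νu : Fin N → ℝ) (μl μu : Fin L → ℝ) (lam : ℝ) : Prop :=
  (∀ n, 0 ≤ ξl n) ∧ (∀ n, 0 ≤ ξu n) ∧ (∀ n, 0 ≤ νl n) ∧ (∀ n, 0 ≤ νu n) ∧
  (∀ l, 0 ≤ μl l) ∧ (∀ l, 0 ≤ μu l) ∧
  (∀ n, (K : ℝ) * P.cb' n ((P.γb n / αb n) * qb n) + ξu n - ξl n - δ n
      = P.price lam μl μu n) ∧
  (∀ n, (K : ℝ) * P.cp' n ((P.γp n / αp n) * qp n) + νu n - νl n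
      = P.price lam μl μu n) ∧
  (∑ n, (ξl n * (P.qlb n - qb n) + ξu n * (qb n - P.qub n)) = 0) ∧
  (∑ n, (νl n * (P.plb n - qp n) + νu n * (qp n - P.pub n)) = 0) ∧
  (∑ l, (μl l * (-P.f l - P.H.mulVec (P.inj qb qp 0 d1) l)
       + μu l * (P.H.mulVec (P.inj qb qp 0 d1) l - P.f l)) = 0)

/-- The KKT system of `F̂R(qᵇ,qᵖ,d_s)`. -/
def FRHatKKT (αp : Fin N → ℝ) (ds qb qp r : Fin N → ℝ)
    (νl νu : Fin N → ℝ) (μl μu : Fin L → ℝ) (lam : ℝ) : Prop :=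
  (∀ n, 0 ≤ νl n) ∧ (∀ n, 0 ≤ νu n) ∧
  (∀ l, 0 ≤ μl l) ∧ (∀ l, 0 ≤ μu l) ∧
  (∀ n, P.cp' n ((P.γp n / αp n) * (qp n + r n)) + νu n - νl n
      = P.price lam μl μu n) ∧
  (∑ n, (νl n * (P.plb n - (qp n + r n)) + νu n * ((qp n + r n) - P.pub n)) = 0) ∧
  (∑ l, (μl l * (-P.f l - P.H.mulVec (P.inj qb qp r ds) l)
       + μu l * (P.H.mulVec (P.inj qb qp r ds) l - P.f l)) = 0)

/-- Dispatch production setpoint `qₙᵇ = [αₙᵇ sₙᵇ(πₙᵇ)]` of the market. -/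
def schedQb (αb πb : Fin N → ℝ) (n : Fin N) : ℝ :=
  clamp (αb n * P.sb n (πb n)) (P.qlb n) (P.qub n)

/-- Regulation production setpoint `qₙᵖ = [αₙᵖ sₙᵖ(π_{1,n}ᵖ)]` of the market. -/
def schedQp (s1 : S) (αp : Fin N → ℝ) (πp : S → Fin N → ℝ) (n : Fin N) : ℝ :=
  clamp (αp n * P.sp n (πp s1 n)) (P.plb n) (P.pub n)

/-- Regulation recourse `r_{s,n} = [αₙᵖ sₙᵖ(π_{s,n}ᵖ)] − qₙᵖ` of the market. -/
def schedR (s1 : S) (αp : Fin N → ℝ) (πp : S → Fin N → ℝ) (s : S) (n : Fin N) : ℝ :=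
  clamp (αp n * P.sp n (πp s n)) (P.plb n) (P.pub n) - P.schedQp s1 αp πp n

/-- Competitive equilibrium (Definition 2): bids `(αᵇ,αᵖ)` and prices
`(πᵇ,(π_sᵖ))` such that (a) each `αₙᵇ` maximizes the dispatch generator's
profit, (b) each `αₙᵖ` maximizes the regulation generator's expected profit,
(c) the prices `πᵇ` and `π₁ᵖ` come from KKT multipliers at an optimal solution
of `ÊD(d₁)`, and (d) each `π_sᵖ` comes from KKT multipliers at an optimal
solution of `F̂R(qᵇ,qᵖ,d_s)` evaluated at the market production setpoints. -/
def CompetitiveEquilibrium (s1 : S) (K : ℕ) (p : S → ℝ) (d : S → Fin N → ℝ)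
    (δ : Fin N → ℝ) (αb αp : Fin N → ℝ) (πb : Fin N → ℝ)
    (πp : S → Fin N → ℝ) : Prop :=
  (∀ n, 0 < αb n) ∧ (∀ n, 0 < αp n) ∧
  -- (a)
  (∀ n, ∀ α > (0 : ℝ),
    (K : ℝ) * (πb n * clamp (α * P.sb n (πb n)) (P.qlb n) (P.qub n)
      - P.cb n (clamp (α * P.sb n (πb n)) (P.qlb n) (P.qub n))) ≤
    (K : ℝ) * (πb n * clamp (αb n * P.sb n (πb n)) (P.qlb n) (P.qub n)
      - P.cb n (clamp (αb n * P.sb n (πb n)) (P.qlb n) (P.qub n)))) ∧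
  -- (b)
  (∀ n, ∀ α > (0 : ℝ),
    ∑ s, p s * (πp s n * clamp (α * P.sp n (πp s n)) (P.plb n) (P.pub n)
      - P.cp n (clamp (α * P.sp n (πp s n)) (P.plb n) (P.pub n))) ≤
    ∑ s, p s * (πp s n * clamp (αp n * P.sp n (πp s n)) (P.plb n) (P.pub n)
      - P.cp n (clamp (αp n * P.sp n (πp s n)) (P.plb n) (P.pub n)))) ∧
  -- (c)
  (∃ (qb qp : Fin N → ℝ) (ξl ξu νl νu : Fin N → ℝ) (μl μu : Fin L → ℝ) (lam : ℝ),
    P.EDHatOpt K δ αb αp (d s1) qb qp ∧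
    P.EDHatKKT K δ αb αp (d s1) qb qp ξl ξu νl νu μl μu lam ∧
    (∀ n, πb n = ((K : ℝ))⁻¹ * (P.price lam μl μu n + δ n)) ∧
    (∀ n, πp s1 n = ((K : ℝ))⁻¹ * P.price lam μl μu n)) ∧
  -- (d)
  (∀ s : S, ∃ (r : Fin N → ℝ) (νl νu : Fin N → ℝ) (μl μu : Fin L → ℝ) (lam : ℝ),
    P.FRHatOpt αp (d s) (P.schedQb αb πb) (P.schedQp s1 αp πp) r ∧
    P.FRHatKKT αp (d s) (P.schedQb αb πb) (P.schedQp s1 αp πp) r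
      νl νu μl μu lam ∧
    (∀ n, πp s n = P.price lam μl μu n))

end MarketNet

/-- At price `π`, a producer with marginal cost `g` and capacity interval `[a,b]` has no
profitable marginal deviation from `q`. -/
def IsPriceResponse (g : ℝ → ℝ) (a b q π : ℝ) : Prop :=
  a ≤ q ∧ q ≤ b ∧ (q < b → π ≤ g q) ∧ (a < q → g q ≤ π)

theorem IsPriceResponse.eq_of_mul_nonpos {g : ℝ → ℝ} {a b q π q' π' : ℝ}
    (hg : StrictMonoOn g (Set.Ioi 0)) (ha : 0 < a)
    (h : IsPriceResponse g a b q π) (h' : IsPriceResponse g a b q' π')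
    (hmul : (π - π') * (q - q') ≤ 0) : q = q' := by
  obtain ⟨h1, h2, h3, h4⟩ := h
  obtain ⟨h1', h2', h3', h4'⟩ := h'
  have hq : q ∈ Set.Ioi (0 : ℝ) := ha.trans_le h1
  have hq' : q' ∈ Set.Ioi (0 : ℝ) := ha.trans_le h1'
  rcases lt_trichotomy q q' with hlt | heq | hlt
  · have := hg hq hq' hlt
    have := h3 (hlt.trans_le h2')
    have := h4' (h1.trans_lt hlt)
    nlinarith
  · exact heq
  · have := hg hq' hq hlt
    have := h3' (hlt.trans_le h2)
    have := h4 (h1'.trans_lt hlt)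
    nlinarith

theorem isPriceResponse_of_multipliers {g : ℝ → ℝ} {a b q π νl νu : ℝ}
    (ha : a ≤ q) (hb : q ≤ b) (hl : 0 ≤ νl) (hu : 0 ≤ νu)
    (hstat : g q + νu - νl = π) (hcl : νl * (a - q) = 0) (hcu : νu * (q - b) = 0) :
    IsPriceResponse g a b q π := by
  refine ⟨ha, hb, fun h => ?_, fun h => ?_⟩
  · rcases mul_eq_zero.mp hcu with h0 | h0 <;> linarith
  · rcases mul_eq_zero.mp hcl with h0 | h0 <;> linarith

theorem isPriceResponse_clamp {g : ℝ → ℝ} {a b y π : ℝ}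
    (hg : StrictMonoOn g (Set.Ioi 0)) (ha : 0 < a) (hab : a ≤ b) (hy : 0 < y) (hgy : g y = π) :
    IsPriceResponse g a b (clamp y a b) π := by
  have h1 : a ≤ clamp y a b := le_min (le_max_right _ _) hab
  refine ⟨h1, min_le_right _ _, fun h => ?_, fun h => ?_⟩
  · rw [← hgy]
    refine hg.monotoneOn hy (ha.trans_le h1) ?_
    unfold clamp at h ⊢
    rcases min_lt_iff.mp h with h | h
    · rw [min_eq_left h.le]; exact le_max_left _ _
    · exact absurd h (lt_irrefl _)
  · rw [← hgy]
    refine hg.monotoneOn (ha.trans_le h1) hy ?_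
    unfold clamp at h ⊢
    rcases lt_max_iff.mp (lt_min_iff.mp h).1 with h | h
    · rw [max_eq_left h.le]; exact min_le_left _ _
    · exact absurd h (lt_irrefl _)

theorem StrictConvexOn.add_deriv_mul_lt {c : ℝ → ℝ} {s : Set ℝ} {c' x y : ℝ}
    (hc : StrictConvexOn ℝ s c) (hx : x ∈ s) (hy : y ∈ s) (hd : HasDerivAt c c' y)
    (hxy : x ≠ y) : c y + c' * (x - y) < c x := by
  rcases lt_or_gt_of_ne hxy with h | h
  · have := hc.slope_lt_of_hasDerivAt hx hy h hd
    rw [slope_def_field, div_lt_iff₀ (sub_pos.mpr h)] at this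
    linarith
  · have := hc.lt_slope_of_hasDerivAt hy hx h hd
    rw [slope_def_field, lt_div_iff₀ (sub_pos.mpr h)] at this
    linarith

theorem IsPriceResponse.profit_lt {c g : ℝ → ℝ} {a b q π x : ℝ}
    (hc : StrictConvexOn ℝ (Set.Ioi 0) c) (hd : ∀ z ∈ Set.Ioi (0 : ℝ), HasDerivAt c (g z) z)
    (ha : 0 < a) (h : IsPriceResponse g a b q π) (hax : a ≤ x) (hxb : x ≤ b) (hne : x ≠ q) :
    π * x - c x < π * q - c q := by
  obtain ⟨h1, h2, h3, h4⟩ := h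
  have hq : q ∈ Set.Ioi (0 : ℝ) := ha.trans_le h1
  have key := hc.add_deriv_mul_lt (ha.trans_le hax) hq (hd q hq) hne
  rcases lt_or_gt_of_ne hne with hlt | hlt
  · nlinarith [h4 (hax.trans_lt hlt)]
  · nlinarith [h3 (hlt.trans_le hxb)]

theorem mul_slack_eq_zero {ι : Type*} [Fintype ι] {u v x y : ι → ℝ}
    (hu : ∀ i, 0 ≤ u i) (hv : ∀ i, 0 ≤ v i) (hx : ∀ i, x i ≤ 0) (hy : ∀ i, y i ≤ 0)
    (h : ∑ i, (u i * x i + v i * y i) = 0) (i : ι) : u i * x i = 0 ∧ v i * y i = 0 := by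
  have hux := fun i => mul_nonpos_of_nonneg_of_nonpos (hu i) (hx i)
  have hvy := fun i => mul_nonpos_of_nonneg_of_nonpos (hv i) (hy i)
  have h0 := (Finset.sum_eq_zero_iff_of_nonpos
    (fun i _ => add_nonpos (hux i) (hvy i))).mp h i (Finset.mem_univ i)
  constructor <;> linarith [hux i, hvy i]

namespace MarketNet

variable {N L : ℕ} (P : MarketNet N L)

theorem sum_price_mul (lam : ℝ) (μl μu : Fin L → ℝ) {x : Fin N → ℝ} (hx : ∑ n, x n = 0) :
    ∑ n, P.price lam μl μu n * x n = ∑ l, (μl l - μu l) * P.H.mulVec x l := by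
  have h : (P.Hᵀ.mulVec (μl - μu)) ⬝ᵥ x = (μl - μu) ⬝ᵥ P.H.mulVec x := by
    rw [Matrix.mulVec_transpose, Matrix.dotProduct_mulVec]
  simp only [price, add_mul, Finset.sum_add_distrib, ← Finset.mul_sum, hx, mul_zero, zero_add]
  exact h

/-- Complementary line multipliers make the injections minimize the value `∑ πₙ xₙ` among
all injections satisfying balance and line limits. -/
theorem sum_price_mul_inj_le {lam : ℝ} {μl μu : Fin L → ℝ} {qb qp r d qb' qp' r' : Fin N → ℝ}
    (hl : ∀ l, 0 ≤ μl l) (hu : ∀ l, 0 ≤ μu l)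
    (hΩ : P.Omega d qb qp r) (hΩ' : P.Omega d qb' qp' r')
    (hcs : ∑ l, (μl l * (-P.f l - P.H.mulVec (P.inj qb qp r d) l)
       + μu l * (P.H.mulVec (P.inj qb qp r d) l - P.f l)) = 0) :
    ∑ n, P.price lam μl μu n * P.inj qb qp r d n ≤
      ∑ n, P.price lam μl μu n * P.inj qb' qp' r' d n := by
  rw [P.sum_price_mul (x := P.inj qb qp r d) _ _ _ hΩ.2.2.1,
    P.sum_price_mul (x := P.inj qb' qp' r' d) _ _ _ hΩ'.2.2.1]
  refine Finset.sum_le_sum fun l _ => ?_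
  obtain ⟨h1, h2⟩ := mul_slack_eq_zero hl hu
    (fun l => by linarith [(hΩ.2.2.2 l).1]) (fun l => by linarith [(hΩ.2.2.2 l).2]) hcs l
  nlinarith [mul_nonneg (hl l) (neg_le_iff_add_nonneg.mp (hΩ'.2.2.2 l).1),
    mul_nonneg (hu l) (sub_nonneg.mpr (hΩ'.2.2.2 l).2)]

/-- Injections supported by nodal prices respond antitonically to those prices. -/
theorem sum_price_sub_mul_inj_sub_nonpos {lam lam' : ℝ} {μl μu μl' μu' : Fin L → ℝ}
    {qb qp r d qb' qp' r' : Fin N → ℝ}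
    (hl : ∀ l, 0 ≤ μl l) (hu : ∀ l, 0 ≤ μu l) (hl' : ∀ l, 0 ≤ μl' l) (hu' : ∀ l, 0 ≤ μu' l)
    (hΩ : P.Omega d qb qp r) (hΩ' : P.Omega d qb' qp' r')
    (hcs : ∑ l, (μl l * (-P.f l - P.H.mulVec (P.inj qb qp r d) l)
       + μu l * (P.H.mulVec (P.inj qb qp r d) l - P.f l)) = 0)
    (hcs' : ∑ l, (μl' l * (-P.f l - P.H.mulVec (P.inj qb' qp' r' d) l)
       + μu' l * (P.H.mulVec (P.inj qb' qp' r' d) l - P.f l)) = 0) :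
    ∑ n, (P.price lam μl μu n - P.price lam' μl' μu' n) *
      ((qb n - qb' n) + ((qp n + r n) - (qp' n + r' n))) ≤ 0 := by
  have h1 := P.sum_price_mul_inj_le (lam := lam) hl hu hΩ hΩ' hcs
  have h2 := P.sum_price_mul_inj_le (lam := lam') hl' hu' hΩ' hΩ hcs'
  have h3 : ∑ n, (P.price lam μl μu n - P.price lam' μl' μu' n) *
      ((qb n - qb' n) + ((qp n + r n) - (qp' n + r' n))) =
      (∑ n, P.price lam μl μu n * P.inj qb qp r d n
        - ∑ n, P.price lam μl μu n * P.inj qb' qp' r' d n) +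
      (∑ n, P.price lam' μl' μu' n * P.inj qb' qp' r' d n
        - ∑ n, P.price lam' μl' μu' n * P.inj qb qp r d n) := by
    simp only [← Finset.sum_sub_distrib, ← Finset.sum_add_distrib]
    refine Finset.sum_congr rfl fun n _ => ?_
    simp only [inj]
    ring
  linarith

end MarketNet

/-- Two families of price responses whose total price-quantity variation is nonpositive
coincide. -/
theorem IsPriceResponse.eq_of_sum_mul_nonpos {ι : Type*} [Fintype ι] {g : ι → ℝ → ℝ}
    {a b q π q' π' : ι → ℝ} (hg : ∀ i, StrictMonoOn (g i) (Set.Ioi 0)) (ha : ∀ i, 0 < a i)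
    (h : ∀ i, IsPriceResponse (g i) (a i) (b i) (q i) (π i))
    (h' : ∀ i, IsPriceResponse (g i) (a i) (b i) (q' i) (π' i))
    (hsum : ∑ i, (π i - π' i) * (q i - q' i) ≤ 0) : q = q' := by
  have hnn : ∀ i, 0 ≤ (π i - π' i) * (q i - q' i) := fun i => by
    by_contra! hlt
    have := (h i).eq_of_mul_nonpos (hg i) (ha i) (h' i) hlt.le
    simp [this] at hlt
  funext i
  refine (h i).eq_of_mul_nonpos (hg i) (ha i) (h' i) ?_
  exact ((Finset.sum_eq_zero_iff_of_nonneg fun i _ => hnn i).mp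
    (le_antisymm hsum (Finset.sum_nonneg fun i _ => hnn i)) i (Finset.mem_univ i)).le

/-- A bid that maximizes a positively weighted sum of profits over scenarios yields the
price response in every scenario. -/
theorem isPriceResponse_of_bid_optimal {S : Type*} [Fintype S] {c g : ℝ → ℝ} {a b γ α : ℝ}
    {w π y : S → ℝ}
    (hc : StrictConvexOn ℝ (Set.Ioi 0) c) (hd : ∀ z ∈ Set.Ioi (0 : ℝ), HasDerivAt c (g z) z)
    (hg : StrictMonoOn g (Set.Ioi 0)) (ha : 0 < a) (hab : a ≤ b) (hγ : 0 < γ)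
    (hw : ∀ s, 0 < w s) (hy : ∀ s, 0 < y s) (hgy : ∀ s, g (y s) = π s)
    (hopt : ∀ β > (0 : ℝ),
      ∑ s, w s * (π s * clamp (β * (y s / γ)) a b - c (clamp (β * (y s / γ)) a b)) ≤
      ∑ s, w s * (π s * clamp (α * (y s / γ)) a b - c (clamp (α * (y s / γ)) a b)))
    (s : S) : IsPriceResponse g a b (clamp (α * (y s / γ)) a b) (π s) := by
  have hγy : ∀ s, γ * (y s / γ) = y s := fun s => mul_div_cancel₀ _ hγ.ne'
  have hresp := fun s => isPriceResponse_clamp hg ha hab (hy s) (hgy s)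
  have hlt := fun s (hne : clamp (α * (y s / γ)) a b ≠ clamp (y s) a b) =>
    (hresp s).profit_lt hc hd ha (le_min (le_max_right _ _) hab) (min_le_right _ _) hne
  have heq : clamp (α * (y s / γ)) a b = clamp (y s) a b := by
    by_contra hne
    have hγopt := hopt γ hγ
    simp only [hγy] at hγopt
    refine absurd hγopt (not_le.mpr (Finset.sum_lt_sum (fun t _ => ?_) ⟨s, Finset.mem_univ s, ?_⟩))
    · by_cases ht : clamp (α * (y t / γ)) a b = clamp (y t) a b
      · rw [ht]
      · exact mul_le_mul_of_nonneg_left (hlt t ht).le (hw t).le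
    · exact mul_lt_mul_of_pos_left (hlt s hne) (hw s)
  rw [heq]
  exact hresp s

/-- **Proposition 3(a), efficiency of competitive equilibria.**
Assume the δ-hypothesis. Then for every competitive equilibrium with bids
`(αᵇ,αᵖ)` and prices `(πᵇ,(π_sᵖ))`, its production schedule
`(qᵇ, qᵖ, (r_s))` (which satisfies `r_1 = 0`) is an optimal solution of
SYSTEM. -/
theorem competitive_equilibrium_efficient
    {N L : ℕ} (P : MarketNet N L) (hP : P.Sane)
    {S : Type} [Fintype S] (s1 : S)
    (K : ℕ) (hK : 1 ≤ K)
    (p : S → ℝ) (hp : ∀ s, 0 < p s) (hpsum : ∑ s, p s = (K : ℝ)) (hp1 : p s1 = 1)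
    (d : S → Fin N → ℝ) (δ : Fin N → ℝ)
    (hδ : P.DeltaHyp s1 K p d δ)
    (αb αp πb : Fin N → ℝ) (πp : S → Fin N → ℝ)
    (hce : P.CompetitiveEquilibrium s1 K p d δ αb αp πb πp) :
    P.schedR s1 αp πp s1 = 0 ∧
    P.SysOpt s1 p d (P.schedQb αb πb) (P.schedQp s1 αp πp)
      (P.schedR s1 αp πp) := by
  obtain ⟨-, -, -, hqlb, hqub, hplb, hpub, hdb, hdp, hcb, hcp, hmb, hmp, -, -, hib, hip, -, -,
    hγb, hγp⟩ := hP
  obtain ⟨-, hαp, hbidb, hbidp, ⟨_, _, _, _, _, _, _, _, _, -, -, hπb, hπ1⟩, hFR⟩ := hce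
  obtain ⟨qb, qp, r, ξl, ξu, νl, νu, μl, μu, lam, hopt,
    ⟨hξl, hξu, hνl, hνu, hμl, hμu, hstb, hcsb, hstp, hcsp, hcsμ⟩, hδ⟩ := hδ
  have hK0 : (0 : ℝ) < K := by exact_mod_cast hK
  have hr1 : P.schedR s1 αp πp s1 = 0 := by
    funext n
    simp [MarketNet.schedR, MarketNet.schedQp]
  refine ⟨hr1, ?_⟩
  have hq : ∀ s n, P.schedQp s1 αp πp n + P.schedR s1 αp πp s n
      = clamp (αp n * P.sp n (πp s n)) (P.plb n) (P.pub n) := fun s n => by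
    simp [MarketNet.schedR]
  have hrespb : ∀ n, IsPriceResponse (P.cb' n) (P.qlb n) (P.qub n)
      (P.schedQb αb πb n) (πb n) := fun n => by
    refine isPriceResponse_of_bid_optimal (S := Unit) (w := fun _ => (K : ℝ))
      (π := fun _ => πb n) (y := fun _ => P.cbInv n (πb n)) (hcb n) (hdb n) (hmb n) (hqlb n)
      (hqub n) (hγb n) (fun _ => hK0) (fun _ => (hib n _).1) (fun _ => (hib n _).2)
      (fun β hβ => ?_) ()
    simpa [MarketNet.sb] using hbidb n β hβ
  have hrespp : ∀ s n, IsPriceResponse (P.cp' n) (P.plb n) (P.pub n)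
      (P.schedQp s1 αp πp n + P.schedR s1 αp πp s n) (πp s n) := fun s n => by
    rw [hq]
    exact isPriceResponse_of_bid_optimal (w := p) (π := fun s => πp s n)
      (y := fun s => P.cpInv n (πp s n)) (hcp n) (hdp n) (hmp n) (hplb n)
      (hpub n) (hγp n) hp (fun _ => (hip n _).1) (fun _ => (hip n _).2) (hbidp n) s
  have hoptb : ∀ n, IsPriceResponse (P.cb' n) (P.qlb n) (P.qub n) (qb n)
      ((K : ℝ)⁻¹ * ∑ s, p s * P.price (lam s) (μl s) (μu s) n) := fun n => by
    have hΩ := (hopt.1.1 s1).1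
    obtain ⟨h1, h2⟩ := mul_slack_eq_zero hξl hξu
      (fun n => by linarith [(hΩ n).1]) (fun n => by linarith [(hΩ n).2]) hcsb n
    refine isPriceResponse_of_multipliers (νl := (K : ℝ)⁻¹ * ξl n) (νu := (K : ℝ)⁻¹ * ξu n)
      (hΩ n).1 (hΩ n).2 (mul_nonneg (inv_nonneg.mpr hK0.le) (hξl n))
      (mul_nonneg (inv_nonneg.mpr hK0.le) (hξu n)) ?_ ?_ ?_
    · rw [← hstb n]; field_simp
    · rw [mul_assoc, h1, mul_zero]
    · rw [mul_assoc, h2, mul_zero]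
  have hoptp : ∀ s n, IsPriceResponse (P.cp' n) (P.plb n) (P.pub n) (qp n + r s n)
      (P.price (lam s) (μl s) (μu s) n) := fun s n => by
    have hΩ := (hopt.1.1 s).2.1
    obtain ⟨h1, h2⟩ := mul_slack_eq_zero (hνl s) (hνu s)
      (fun n => by linarith [(hΩ n).1]) (fun n => by linarith [(hΩ n).2]) (hcsp s) n
    exact isPriceResponse_of_multipliers (hΩ n).1 (hΩ n).2 (hνl s n) (hνu s n) (hstp s n) h1 h2
  have hnet : ∀ s, ∑ n, (πp s n - P.price (lam s) (μl s) (μu s) n) *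
      ((P.schedQb αb πb n - qb n) +
        ((P.schedQp s1 αp πp n + P.schedR s1 αp πp s n) - (qp n + r s n))) ≤ 0 := fun s => by
    obtain ⟨r', νl', νu', μl', μu', lam', ⟨hΩ, -⟩,
      ⟨hνl', hνu', hμl', hμu', hst', hcs', hcsμ'⟩, hπ⟩ := hFR s
    have hr' : r' = P.schedR s1 αp πp s := by
      funext n
      have hκ : 0 < P.γp n / αp n := div_pos (hγp n) (hαp n)
      have hmono : StrictMonoOn (fun x => P.cp' n ((P.γp n / αp n) * x)) (Set.Ioi 0) :=
        fun x hx y hy hxy => hmp n (mul_pos hκ hx) (mul_pos hκ hy) (mul_lt_mul_of_pos_left hxy hκ)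
      obtain ⟨h1, h2⟩ := mul_slack_eq_zero hνl' hνu'
        (fun n => by linarith [(hΩ.2.1 n).1]) (fun n => by linarith [(hΩ.2.1 n).2]) hcs' n
      have hR := isPriceResponse_of_multipliers
        (g := fun x => P.cp' n ((P.γp n / αp n) * x)) (hΩ.2.1 n).1 (hΩ.2.1 n).2
        (hνl' n) (hνu' n) (hst' n) h1 h2
      rw [← hπ n] at hR
      have hS : 0 < P.sp n (πp s n) := div_pos (hip n _).1 (hγp n)
      have hC := isPriceResponse_clamp hmono (hplb n) (hpub n) (mul_pos (hαp n) hS)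
        (π := πp s n) (by
          have hα := (hαp n).ne'
          have hγ := (hγp n).ne'
          have : P.γp n / αp n * (αp n * P.sp n (πp s n)) = P.cpInv n (πp s n) := by
            unfold MarketNet.sp; field_simp
          simp only [this, (hip n _).2])
      have := hR.eq_of_mul_nonpos hmono (hplb n) hC (by simp)
      rw [← hq s n] at this
      linarith
    subst hr'
    simp only [hπ]
    exact P.sum_price_sub_mul_inj_sub_nonpos hμl' hμu' (hμl s) (hμu s) hΩ (hopt.1.1 s)
      hcsμ' (hcsμ s)
  have hgap : ∀ n, πb n - (K : ℝ)⁻¹ * ∑ s, p s * P.price (lam s) (μl s) (μu s) n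
      = πp s1 n - P.price (lam s1) (μl s1) (μu s1) n := fun n => by
    rw [hπb n, hπ1 n, hδ n]
    simp only [mul_sub, Finset.sum_sub_distrib, ← Finset.sum_mul, hpsum]
    field_simp
    ring
  have hbase : Sum.elim (P.schedQb αb πb) (fun n => P.schedQp s1 αp πp n + P.schedR s1 αp πp s1 n)
      = Sum.elim qb (fun n => qp n + r s1 n) := by
    refine IsPriceResponse.eq_of_sum_mul_nonpos (g := Sum.elim P.cb' P.cp')
      (a := Sum.elim P.qlb P.plb) (b := Sum.elim P.qub P.pub) (π := Sum.elim πb (πp s1))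
      (π' := Sum.elim (fun n => (K : ℝ)⁻¹ * ∑ s, p s * P.price (lam s) (μl s) (μu s) n)
        (P.price (lam s1) (μl s1) (μu s1)))
      (Sum.rec hmb hmp) (Sum.rec hqlb hplb) (Sum.rec hrespb (hrespp s1))
      (Sum.rec hoptb (hoptp s1)) ?_
    have h := hnet s1
    simp only [mul_add, Finset.sum_add_distrib] at h
    simpa [Fintype.sum_sum_type, hgap, mul_add] using h
  have hqb : P.schedQb αb πb = qb := funext fun n => congrFun hbase (Sum.inl n)
  have hqp : P.schedQp s1 αp πp = qp := funext fun n => by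
    simpa [hr1, hopt.1.2] using congrFun hbase (Sum.inr n)
  have hr : P.schedR s1 αp πp = r := funext fun s => by
    have h := IsPriceResponse.eq_of_sum_mul_nonpos hmp hplb (hrespp s) (hoptp s)
      (by simpa [hqb] using hnet s)
    funext n
    simpa [hqp] using congrFun h n
  rw [hqb, hqp, hr]
  exact hopt
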